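/- arXiv:2501.16479 — 3 statements merged into one kernel-verified Lean document; each statement's English description precedes it below -/
import Mathlib

section
/- Let d ≥ 1. Let χ : ℝ → Matrix (Fin d) (Fin d) ℝ be continuously differentiable, f : ℝ → ℝ twice continuously differentiable, and U, π, ρ : ℝ^d → ℝ smooth. For a smooth σ : ℝ^d → ℝ define the current J(σ)(x) := χ(σ(x)) • (−∇U(x)) − f''(σ(x)) · (χ(σ(x)) • ∇σ(x)) (this encodes the external field E = −∇U and the local Einstein relation D(σ) = χ(σ) f''(σ)). Assume that J(π)(x) = 0 and that the matrix χ(π(x)) is positive definite for every x ∈ ℝ^d. Then for every x ∈ ℝ^d, J(ρ)(x) = −χ(ρ(x)) • ∇(f' ∘ ρ − f' ∘ π)(x); that is, the current is proportional, with mobility χ(ρ), to the thermodynamic force ∇(f'(ρ) − f'(π)). -/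
open scoped Matrix

/-- Matrix–vector multiplication on `EuclideanSpace ℝ (Fin d)`. -/
noncomputable def mvec {d : ℕ} (A : Matrix (Fin d) (Fin d) ℝ)
    (v : EuclideanSpace ℝ (Fin d)) : EuclideanSpace ℝ (Fin d) :=
  (EuclideanSpace.equiv (Fin d) ℝ).symm (A.mulVec (EuclideanSpace.equiv (Fin d) ℝ v))

/-- The current `J(σ)(x) = χ(σ(x)) • (−∇U(x)) − f''(σ(x)) · (χ(σ(x)) • ∇σ(x))`. -/
noncomputable def current {d : ℕ} (χ : ℝ → Matrix (Fin d) (Fin d) ℝ) (f : ℝ → ℝ)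
    (U : EuclideanSpace ℝ (Fin d) → ℝ) (σ : EuclideanSpace ℝ (Fin d) → ℝ)
    (x : EuclideanSpace ℝ (Fin d)) : EuclideanSpace ℝ (Fin d) :=
  mvec (χ (σ x)) (-(gradient U x)) -
    deriv (deriv f) (σ x) • mvec (χ (σ x)) (gradient σ x)

theorem mvec_add_aux {d : ℕ} (A : Matrix (Fin d) (Fin d) ℝ)
    (v w : EuclideanSpace ℝ (Fin d)) : mvec A (v + w) = mvec A v + mvec A w := by
  simp only [mvec, map_add, Matrix.mulVec_add]

theorem mvec_smul_aux {d : ℕ} (A : Matrix (Fin d) (Fin d) ℝ) (c : ℝ)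
    (v : EuclideanSpace ℝ (Fin d)) : mvec A (c • v) = c • mvec A v := by
  simp only [mvec, map_smul, Matrix.mulVec_smul]

theorem mvec_neg_aux {d : ℕ} (A : Matrix (Fin d) (Fin d) ℝ)
    (v : EuclideanSpace ℝ (Fin d)) : mvec A (-v) = -mvec A v := by
  simp only [mvec, map_neg, Matrix.mulVec_neg]

theorem mvec_inj_aux {d : ℕ} (A : Matrix (Fin d) (Fin d) ℝ)
    (hA : ∀ v : Fin d → ℝ, v ≠ 0 → 0 < v ⬝ᵥ A.mulVec v)
    (v : EuclideanSpace ℝ (Fin d)) (h : mvec A v = 0) : v = 0 := by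
  unfold mvec at h
  rw [EmbeddingLike.map_eq_zero_iff] at h
  by_contra hv
  have := hA (EuclideanSpace.equiv (Fin d) ℝ v)
    (by rwa [Ne, EmbeddingLike.map_eq_zero_iff])
  rw [h] at this
  simp at this

theorem hasGradientAt_comp_aux {d : ℕ} (g : ℝ → ℝ) (hg : Differentiable ℝ g)
    (σ : EuclideanSpace ℝ (Fin d) → ℝ) (hσ : Differentiable ℝ σ)
    (x : EuclideanSpace ℝ (Fin d)) :
    HasGradientAt (fun y => g (σ y)) (deriv g (σ x) • gradient σ x) x := by
  have h := (hg (σ x)).hasDerivAt.comp_hasFDerivAt x (hσ x).hasGradientAt.hasFDerivAt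
  rw [hasGradientAt_iff_hasFDerivAt]
  rw [map_smulₛₗ]
  exact h

/-- under the local Einstein relation and `J(π) = 0` with `χ(π(x))`
positive definite, the current is proportional to the thermodynamic force:
`J(ρ) = −χ(ρ) • ∇(f'∘ρ − f'∘π)`. -/
theorem onsager_reciprocal_relation (d : ℕ) (hd : 1 ≤ d)
    (χ : ℝ → Matrix (Fin d) (Fin d) ℝ)
    (hχ : ∀ i j, ContDiff ℝ 1 fun r => χ r i j)
    (f : ℝ → ℝ) (hf : ContDiff ℝ 2 f)
    (U π ρ : EuclideanSpace ℝ (Fin d) → ℝ)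
    (hU : ContDiff ℝ (⊤ : ℕ∞) U) (hπ : ContDiff ℝ (⊤ : ℕ∞) π) (hρ : ContDiff ℝ (⊤ : ℕ∞) ρ)
    (hπstat : ∀ x, current χ f U π x = 0)
    (hpos : ∀ (x : EuclideanSpace ℝ (Fin d)) (v : Fin d → ℝ), v ≠ 0 →
      0 < v ⬝ᵥ (χ (π x)).mulVec v) :
    ∀ x, current χ f U ρ x =
      -(mvec (χ (ρ x)) (gradient (fun y => deriv f (ρ y) - deriv f (π y)) x)) := by
  intro x
  have hf' : Differentiable ℝ (deriv f) :=
    ((contDiff_succ_iff_deriv (n := 1)).1 (by simpa [one_add_one_eq_two] using hf)).2.2.differentiable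
      (by simp)
  have h1 := hasGradientAt_comp_aux (deriv f) hf' ρ (hρ.differentiable (by simp)) x
  have h2 := hasGradientAt_comp_aux (deriv f) hf' π (hπ.differentiable (by simp)) x
  have h3 : gradient (fun y => deriv f (ρ y) - deriv f (π y)) x =
      deriv (deriv f) (ρ x) • gradient ρ x - deriv (deriv f) (π x) • gradient π x := by
    apply HasGradientAt.gradient
    rw [hasGradientAt_iff_hasFDerivAt] at *
    rw [map_sub]
    exact h1.sub h2
  have h4 : -(gradient U x) + -(deriv (deriv f) (π x) • gradient π x) = 0 := by
    apply mvec_inj_aux _ (hpos x)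
    have := hπstat x
    rw [mvec_add_aux, mvec_neg_aux _ (_ • _), mvec_smul_aux, ← sub_eq_add_neg]
    exact this
  have h5 : -(gradient U x) = deriv (deriv f) (π x) • gradient π x := by
    rwa [← sub_eq_add_neg, sub_eq_zero] at h4
  rw [h3, current, h5, sub_eq_add_neg (deriv (deriv f) (ρ x) • gradient ρ x), mvec_add_aux,
    mvec_neg_aux, mvec_smul_aux, mvec_smul_aux]
  abel
end

section
/- Let χ : ℝ → ℝ be smooth and let γ, Φ, η₁, η₂ : ℝ × ℝ → ℝ be jointly smooth and 1-periodic in the space variable x. Assume the continuity equation ∂_t γ + ∂_x( χ(γ) ∂_x Φ ) = 0 holds everywhere, and that each η_i (i = 1,2) satisfies the parallel transport equation ∂_x( χ(γ) ∂_x[ ∂_t η_i + (1/2) χ'(γ) (∂_x Φ)(∂_x η_i) ] − (1/2) ∂_x(χ(γ) ∂_x Φ) · χ'(γ) ∂_x η_i + (1/2) ∂_x(χ(γ) ∂_x η_i) · χ'(γ) ∂_x Φ ) = 0 everywhere. Then the inner product is preserved: for every t, the derivative of t ↦ ∫_0^1 χ(γ(t,x)) · ∂_x η₁(t,x) · ∂_x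 η₂(t,x) dx is zero. -/
open intervalIntegral

/-- Partial derivative in the time variable of a function of `(t, x)`. -/
noncomputable def pt (g : ℝ × ℝ → ℝ) (p : ℝ × ℝ) : ℝ :=
  deriv (fun s => g (s, p.2)) p.1

/-- Partial derivative in the space variable of a function of `(t, x)`. -/
noncomputable def px (g : ℝ × ℝ → ℝ) (p : ℝ × ℝ) : ℝ :=
  deriv (fun y => g (p.1, y)) p.2

/-- The parallel transport equation for `η` along the curve `γ` with potential `Φ`. -/
def ParallelEq (χ : ℝ → ℝ) (γ Φ η : ℝ × ℝ → ℝ) : Prop :=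
  ∀ p : ℝ × ℝ,
    px (fun q =>
      χ (γ q) * px (fun r =>
          pt η r + (1/2 : ℝ) * deriv χ (γ r) * px Φ r * px η r) q
      - (1/2 : ℝ) * px (fun r => χ (γ r) * px Φ r) q * (deriv χ (γ q) * px η q)
      + (1/2 : ℝ) * px (fun r => χ (γ r) * px η r) q * (deriv χ (γ q) * px Φ q)) p = 0


lemma aux_hx {g : ℝ × ℝ → ℝ} (hg : ContDiff ℝ (⊤ : ℕ∞) g) (p : ℝ × ℝ) :
    HasDerivAt (fun y => g (p.1, y)) (fderiv ℝ g p (0, 1)) p.2 := by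
  have h1 : HasFDerivAt g (fderiv ℝ g p) (p.1, p.2) :=
    (hg.differentiable (by simp) p).hasFDerivAt
  have h2 : HasDerivAt (fun y : ℝ => ((p.1, y) : ℝ × ℝ)) (0, 1) p.2 :=
    (hasDerivAt_const p.2 p.1).prodMk (hasDerivAt_id p.2)
  exact h1.comp_hasDerivAt p.2 h2

lemma aux_ht {g : ℝ × ℝ → ℝ} (hg : ContDiff ℝ (⊤ : ℕ∞) g) (p : ℝ × ℝ) :
    HasDerivAt (fun y => g (y, p.2)) (fderiv ℝ g p (1, 0)) p.1 := by
  have h1 : HasFDerivAt g (fderiv ℝ g p) (p.1, p.2) :=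
    (hg.differentiable (by simp) p).hasFDerivAt
  have h2 : HasDerivAt (fun y : ℝ => ((y, p.2) : ℝ × ℝ)) (1, 0) p.1 :=
    (hasDerivAt_id p.1).prodMk (hasDerivAt_const p.1 p.2)
  exact h1.comp_hasDerivAt p.1 h2

lemma aux_px_eq {g : ℝ × ℝ → ℝ} (hg : ContDiff ℝ (⊤ : ℕ∞) g) :
    px g = fun p => fderiv ℝ g p (0, 1) := funext fun p => (aux_hx hg p).deriv

lemma aux_pt_eq {g : ℝ × ℝ → ℝ} (hg : ContDiff ℝ (⊤ : ℕ∞) g) :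
    pt g = fun p => fderiv ℝ g p (1, 0) := funext fun p => (aux_ht hg p).deriv

lemma aux_hpx {g : ℝ × ℝ → ℝ} (hg : ContDiff ℝ (⊤ : ℕ∞) g) (p : ℝ × ℝ) :
    HasDerivAt (fun y => g (p.1, y)) (px g p) p.2 := by
  rw [aux_px_eq hg]; exact aux_hx hg p

lemma aux_hpt {g : ℝ × ℝ → ℝ} (hg : ContDiff ℝ (⊤ : ℕ∞) g) (p : ℝ × ℝ) :
    HasDerivAt (fun y => g (y, p.2)) (pt g p) p.1 := by
  rw [aux_pt_eq hg]; exact aux_ht hg p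

lemma aux_px_smooth {g : ℝ × ℝ → ℝ} (hg : ContDiff ℝ (⊤ : ℕ∞) g) :
    ContDiff ℝ (⊤ : ℕ∞) (px g) := by
  rw [aux_px_eq hg]
  exact (hg.fderiv_right (m := (⊤ : ℕ∞)) (by simp)).clm_apply contDiff_const

lemma aux_pt_smooth {g : ℝ × ℝ → ℝ} (hg : ContDiff ℝ (⊤ : ℕ∞) g) :
    ContDiff ℝ (⊤ : ℕ∞) (pt g) := by
  rw [aux_pt_eq hg]
  exact (hg.fderiv_right (m := (⊤ : ℕ∞)) (by simp)).clm_apply contDiff_const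

lemma aux_comm {g : ℝ × ℝ → ℝ} (hg : ContDiff ℝ (⊤ : ℕ∞) g) (p : ℝ × ℝ) :
    pt (px g) p = px (pt g) p := by
  have hd : DifferentiableAt ℝ (fderiv ℝ g) p :=
    (hg.fderiv_right (m := (⊤ : ℕ∞)) (by simp)).differentiable (by simp) p
  have e (v w : ℝ × ℝ) : fderiv ℝ (fun q => fderiv ℝ g q v) p w
      = fderiv ℝ (fderiv ℝ g) p w v := by
    rw [fderiv_clm_apply hd (differentiableAt_const v)]
    simp
  have hs : IsSymmSndFDerivAt ℝ g p :=
    hg.contDiffAt.isSymmSndFDerivAt (by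
      rw [minSmoothness_of_isRCLikeNormedField]
      exact WithTop.coe_le_coe.2 (le_top : (2 : ℕ∞) ≤ ⊤))
  rw [aux_pt_eq (aux_px_smooth hg), aux_px_eq (aux_pt_smooth hg), aux_px_eq hg, aux_pt_eq hg]
  simp only [e]
  exact hs _ _

lemma aux_px_per {g : ℝ × ℝ → ℝ} (h : ∀ t x, g (t, x + 1) = g (t, x)) (t x : ℝ) :
    px g (t, x + 1) = px g (t, x) := by
  have := deriv_comp_add_const (fun y => g (t, y)) 1 x
  simp only [px]
  rw [← this]
  simp only [h]

lemma aux_pt_per {g : ℝ × ℝ → ℝ} (h : ∀ t x, g (t, x + 1) = g (t, x)) (t x : ℝ) :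
    pt g (t, x + 1) = pt g (t, x) := by
  simp only [pt, h]

lemma aux_px_mul {f g : ℝ × ℝ → ℝ} (hf : ContDiff ℝ (⊤ : ℕ∞) f)
    (hg : ContDiff ℝ (⊤ : ℕ∞) g) (p : ℝ × ℝ) :
    px (fun q => f q * g q) p = px f p * g p + f p * px g p :=
  ((aux_hpx hf p).mul (aux_hpx hg p)).deriv

lemma aux_pt_mul {f g : ℝ × ℝ → ℝ} (hf : ContDiff ℝ (⊤ : ℕ∞) f)
    (hg : ContDiff ℝ (⊤ : ℕ∞) g) (p : ℝ × ℝ) :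
    pt (fun q => f q * g q) p = pt f p * g p + f p * pt g p :=
  ((aux_hpt hf p).mul (aux_hpt hg p)).deriv

lemma aux_px_add {f g : ℝ × ℝ → ℝ} (hf : ContDiff ℝ (⊤ : ℕ∞) f)
    (hg : ContDiff ℝ (⊤ : ℕ∞) g) (p : ℝ × ℝ) :
    px (fun q => f q + g q) p = px f p + px g p :=
  ((aux_hpx hf p).add (aux_hpx hg p)).deriv

lemma aux_px_sub {f g : ℝ × ℝ → ℝ} (hf : ContDiff ℝ (⊤ : ℕ∞) f)
    (hg : ContDiff ℝ (⊤ : ℕ∞) g) (p : ℝ × ℝ) :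
    px (fun q => f q - g q) p = px f p - px g p :=
  ((aux_hpx hf p).sub (aux_hpx hg p)).deriv

lemma aux_px_const (c : ℝ) (p : ℝ × ℝ) : px (fun _ => c) p = 0 := by
  simp [px]

/-- differentiation under the integral sign -/
lemma aux_deriv_int {f : ℝ × ℝ → ℝ} (hf : ContDiff ℝ (⊤ : ℕ∞) f) (t : ℝ) :
    deriv (fun s => ∫ x in (0:ℝ)..1, f (s, x)) t = ∫ x in (0:ℝ)..1, pt f (t, x) := by
  have hc := (aux_pt_smooth hf).continuous
  obtain ⟨C, hC⟩ := ((isCompact_closedBall t 1).prod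
    (isCompact_Icc (a := (0:ℝ)) (b := 1))).exists_bound_of_continuousOn hc.continuousOn
  have hcf := hf.continuous
  refine (intervalIntegral.hasDerivAt_integral_of_dominated_loc_of_deriv_le
    (F := fun s x => f (s, x)) (F' := fun s x => pt f (s, x)) (bound := fun _ => C)
    (Metric.ball_mem_nhds t one_pos) ?_ ?_ ?_ ?_ ?_ ?_).2.deriv
  · refine Filter.Eventually.of_forall fun s => ?_
    exact (by fun_prop : Continuous fun x => f (s, x)).aestronglyMeasurable
  · exact (by fun_prop : Continuous fun x => f (t, x)).intervalIntegrable _ _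
  · exact (by fun_prop : Continuous fun x => pt f (t, x)).aestronglyMeasurable
  · refine Filter.Eventually.of_forall fun x hx s hs => hC (s, x) ⟨?_, ?_⟩
    · exact Metric.ball_subset_closedBall hs
    · rw [Set.uIoc_of_le zero_le_one] at hx
      exact ⟨hx.1.le, hx.2⟩
  · exact intervalIntegrable_const
  · exact Filter.Eventually.of_forall fun x _ s _ => aux_hpt hf (s, x)

lemma aux_int_px {G : ℝ × ℝ → ℝ} (hG : ContDiff ℝ (⊤ : ℕ∞) G)
    (hper : ∀ t x, G (t, x + 1) = G (t, x)) (t : ℝ) :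
    ∫ x in (0:ℝ)..1, px G (t, x) = 0 := by
  have hc := (aux_px_smooth hG).continuous
  rw [intervalIntegral.integral_eq_sub_of_hasDerivAt (f := fun x => G (t, x))
    (fun x _ => aux_hpx hG (t, x))
    ((by fun_prop : Continuous fun x => px G (t, x)).intervalIntegrable _ _)]
  have := hper t 0
  simp only [zero_add] at this
  rw [this, sub_self]

/-- The flux of the parallel transport equation. -/
noncomputable def auxFlux (χ : ℝ → ℝ) (γ Φ η : ℝ × ℝ → ℝ) (q : ℝ × ℝ) : ℝ :=
  χ (γ q) * px (fun r =>
          pt η r + (1/2 : ℝ) * deriv χ (γ r) * px Φ r * px η r) q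
      - (1/2 : ℝ) * px (fun r => χ (γ r) * px Φ r) q * (deriv χ (γ q) * px η q)
      + (1/2 : ℝ) * px (fun r => χ (γ r) * px η r) q * (deriv χ (γ q) * px Φ q)

lemma auxFlux_smooth {χ : ℝ → ℝ} {γ Φ η : ℝ × ℝ → ℝ}
    (hc : ContDiff ℝ (⊤ : ℕ∞) fun q => χ (γ q))
    (hd : ContDiff ℝ (⊤ : ℕ∞) fun q => deriv χ (γ q))
    (hΦ : ContDiff ℝ (⊤ : ℕ∞) Φ) (hη : ContDiff ℝ (⊤ : ℕ∞) η) :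
    ContDiff ℝ (⊤ : ℕ∞) (auxFlux χ γ Φ η) := by
  have hP := aux_px_smooth hΦ
  have ha := aux_px_smooth hη
  have ht := aux_pt_smooth hη
  have h1 := aux_px_smooth (ht.add (((contDiff_const (c := (1/2:ℝ))).mul hd).mul hP |>.mul ha))
  have h2 := aux_px_smooth (hc.mul hP)
  have h3 := aux_px_smooth (hc.mul ha)
  exact ((hc.mul h1).sub ((contDiff_const.mul h2).mul (hd.mul ha))).add
    ((contDiff_const.mul h3).mul (hd.mul hP))

lemma auxFlux_per {χ : ℝ → ℝ} {γ Φ η : ℝ × ℝ → ℝ}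
    (hγ : ∀ t x, γ (t, x + 1) = γ (t, x))
    (hΦ : ∀ t x, Φ (t, x + 1) = Φ (t, x))
    (hη : ∀ t x, η (t, x + 1) = η (t, x)) (t x : ℝ) :
    auxFlux χ γ Φ η (t, x + 1) = auxFlux χ γ Φ η (t, x) := by
  have hP := aux_px_per hΦ
  have ha := aux_px_per hη
  have ht := aux_pt_per hη
  have h1 := aux_px_per (g := fun r =>
          pt η r + (1/2 : ℝ) * deriv χ (γ r) * px Φ r * px η r)
    (by intro t x; simp only [hγ, hP, ha, ht])
  have h2 := aux_px_per (g := fun r => χ (γ r) * px Φ r) (by intro t x; simp only [hγ, hP])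
  have h3 := aux_px_per (g := fun r => χ (γ r) * px η r) (by intro t x; simp only [hγ, ha])
  simp only [auxFlux, h1, h2, h3, hγ, hP, ha]

lemma auxFlux_eq {χ : ℝ → ℝ} {γ Φ η : ℝ × ℝ → ℝ}
    (hc : ContDiff ℝ (⊤ : ℕ∞) fun q => χ (γ q))
    (hd : ContDiff ℝ (⊤ : ℕ∞) fun q => deriv χ (γ q))
    (hΦ : ContDiff ℝ (⊤ : ℕ∞) Φ) (hη : ContDiff ℝ (⊤ : ℕ∞) η) (q : ℝ × ℝ) :
    auxFlux χ γ Φ η q = χ (γ q) * (pt (px η) q + 1/2 *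
        (px (fun q => deriv χ (γ q)) q * px Φ q * px η q
          + deriv χ (γ q) * px (px Φ) q * px η q + deriv χ (γ q) * px Φ q * px (px η) q))
      - 1/2 * px (fun r => χ (γ r) * px Φ r) q * (deriv χ (γ q) * px η q)
      + 1/2 * (px (fun q => χ (γ q)) q * px η q + χ (γ q) * px (px η) q)
        * (deriv χ (γ q) * px Φ q) := by
  have hP := aux_px_smooth hΦ
  have ha := aux_px_smooth hη
  have ht := aux_pt_smooth hη
  have hk : ContDiff ℝ (⊤ : ℕ∞) fun _ : ℝ × ℝ => (1/2 : ℝ) := contDiff_const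
  rw [auxFlux, aux_px_add ht (((hk.mul hd).mul hP).mul ha),
    aux_px_mul ((hk.mul hd).mul hP) ha, aux_px_mul (hk.mul hd) hP, aux_px_mul hk hd,
    aux_px_const, aux_px_mul hc ha, aux_comm hη]
  ring

/-- parallel transport preserves the inner product. -/
theorem parallel_transport_preserves_inner (χ : ℝ → ℝ) (hχ : ContDiff ℝ (⊤ : ℕ∞) χ)
    (γ Φ η₁ η₂ : ℝ × ℝ → ℝ)
    (hγ : ContDiff ℝ (⊤ : ℕ∞) γ) (hΦ : ContDiff ℝ (⊤ : ℕ∞) Φ)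
    (hη₁ : ContDiff ℝ (⊤ : ℕ∞) η₁) (hη₂ : ContDiff ℝ (⊤ : ℕ∞) η₂)
    (hγper : ∀ t x, γ (t, x + 1) = γ (t, x))
    (hΦper : ∀ t x, Φ (t, x + 1) = Φ (t, x))
    (hη₁per : ∀ t x, η₁ (t, x + 1) = η₁ (t, x))
    (hη₂per : ∀ t x, η₂ (t, x + 1) = η₂ (t, x))
    (hcont : ∀ p : ℝ × ℝ, pt γ p + px (fun q => χ (γ q) * px Φ q) p = 0)
    (hpar₁ : ParallelEq χ γ Φ η₁) (hpar₂ : ParallelEq χ γ Φ η₂) :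
    ∀ t : ℝ,
      deriv (fun s => ∫ x in (0:ℝ)..1,
        χ (γ (s, x)) * px η₁ (s, x) * px η₂ (s, x)) t = 0 := by
  intro t
  have hχ' : ContDiff ℝ (⊤ : ℕ∞) (deriv χ) :=
    ((contDiff_infty_iff_deriv (f := χ)).1 hχ).2
  have hc : ContDiff ℝ (⊤ : ℕ∞) fun q => χ (γ q) := hχ.comp hγ
  have hd : ContDiff ℝ (⊤ : ℕ∞) fun q => deriv χ (γ q) := hχ'.comp hγ
  have hP := aux_px_smooth hΦ
  have ha := aux_px_smooth hη₁
  have hb := aux_px_smooth hη₂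
  have hF₁ := auxFlux_smooth hc hd hΦ hη₁
  have hF₂ := auxFlux_smooth hc hd hΦ hη₂
  have hcab := (hc.mul ha).mul hb
  have hM := ((((hc.mul hd).mul hP).mul ha).mul hb)
  have hG := ((hF₁.mul hη₂).add (hF₂.mul hη₁)).sub hM
  have hpar₁' : ∀ p, px (auxFlux χ γ Φ η₁) p = 0 := hpar₁
  have hpar₂' : ∀ p, px (auxFlux χ γ Φ η₂) p = 0 := hpar₂
  have hct (p : ℝ × ℝ) : pt (fun q => χ (γ q)) p = deriv χ (γ p) * pt γ p := by
    have h1 : HasDerivAt χ (deriv χ (γ p)) (γ (p.1, p.2)) :=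
      (hχ.differentiable (by simp) (γ p)).hasDerivAt
    exact (h1.comp p.1 (aux_hpt hγ p)).deriv
  have key (p : ℝ × ℝ) : pt (fun q => χ (γ q) * px η₁ q * px η₂ q) p =
      px (fun q => auxFlux χ γ Φ η₁ q * η₂ q + auxFlux χ γ Φ η₂ q * η₁ q
        - χ (γ q) * deriv χ (γ q) * px Φ q * px η₁ q * px η₂ q) p := by
    rw [aux_px_sub ((hF₁.mul hη₂).add (hF₂.mul hη₁)) hM,
      aux_px_add (hF₁.mul hη₂) (hF₂.mul hη₁), aux_px_mul hF₁ hη₂, aux_px_mul hF₂ hη₁,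
      hpar₁', hpar₂', auxFlux_eq hc hd hΦ hη₁, auxFlux_eq hc hd hΦ hη₂,
      aux_px_mul (((hc.mul hd).mul hP).mul ha) hb, aux_px_mul ((hc.mul hd).mul hP) ha,
      aux_px_mul (hc.mul hd) hP, aux_px_mul hc hd, aux_pt_mul (hc.mul ha) hb,
      aux_pt_mul hc ha, hct, eq_neg_of_add_eq_zero_left (hcont p)]
    ring
  rw [aux_deriv_int hcab t]
  simp only [key]
  refine aux_int_px hG (fun t x => ?_) t
  simp only [auxFlux_per hγper hΦper hη₁per, auxFlux_per hγper hΦper hη₂per, hγper, hη₁per,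
    hη₂per, aux_px_per hΦper, aux_px_per hη₁per, aux_px_per hη₂per]
end

section
/- Let χ : ℝ → ℝ and ρ, Φ₁, Φ₂, Φ₃, Φ₄ : ℝ → ℝ be smooth with ρ, Φ₁, Φ₂, Φ₃, Φ₄ all 1-periodic. Define Δ_χΦ := (χ(ρ)Φ')', G_{ab} := Φ_a''Φ_b' − Φ_b''Φ_a', T(a,b;c,d) := χ(ρ)·( χ'(ρ)·(χ'(ρ)Φ_a'Φ_b')'·Φ_c' )'·Φ_d', and S(a,b;c,d) := χ(ρ)·(χ'(ρ)Φ_a'Φ_b')'·(χ'(ρ)Φ_c'Φ_d')'. Then the one-dimensional Riemannian curvature identity holds: (1/2)∫_0^1 χ''(ρ)·[ −Φ₂'Φ₄'·Δ_χΦ₁·Δ_χΦ₃ − Φ₁'Φ₃'·Δ_χΦ₂·Δ_χΦ₄ + Φ₂'Φ₃'·Δ_χΦ₁·Δ_χΦ₄ + Φ₁'Φ₄'·Δ_χΦ₂·Δ_χΦ₃ ] dx + (1/4)∫_0^1 [ −T(2,4;1,3) − T(2,4;3,1) − T(1,3;2,4) − T(1,3;4,2) + T(2,3;1,4) + T(2,3;4,1)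 + T(1,4;2,3) + T(1,4;3,2) + S(1,3;2,4) − S(2,3;1,4) ] dx + (1/4)∫_0^1 χ(ρ)χ'(ρ)²·[ G₁₃G₂₄ − G₂₃G₁₄ + 2G₃₄G₁₂ ] dx = (1/2)∫_0^1 χ''(ρ)χ(ρ)²·[ −Φ₂'Φ₄'Φ₁''Φ₃'' − Φ₁'Φ₃'Φ₂''Φ₄'' + Φ₂'Φ₃'Φ₁''Φ₄'' + Φ₁'Φ₄'Φ₂''Φ₃'' ] dx. -/
open intervalIntegral

/-- `Δ_χ Φ = (χ(ρ)Φ')'`. -/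
noncomputable def Dchi (χ ρ Φ : ℝ → ℝ) : ℝ → ℝ :=
  fun x => deriv (fun y => χ (ρ y) * deriv Φ y) x

/-- `G_{ab} = Φ_a''Φ_b' − Φ_b''Φ_a'`. -/
noncomputable def Gc (Φa Φb : ℝ → ℝ) : ℝ → ℝ :=
  fun x => deriv (deriv Φa) x * deriv Φb x - deriv (deriv Φb) x * deriv Φa x

/-- `T(a,b;c,d) = χ(ρ)·(χ'(ρ)·(χ'(ρ)Φ_a'Φ_b')'·Φ_c')'·Φ_d'`. -/
noncomputable def Tterm (χ ρ Φa Φb Φc Φd : ℝ → ℝ) : ℝ → ℝ :=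
  fun x => χ (ρ x) *
    deriv (fun y => deriv χ (ρ y) *
      deriv (fun z => deriv χ (ρ z) * deriv Φa z * deriv Φb z) y * deriv Φc y) x *
    deriv Φd x

/-- `S(a,b;c,d) = χ(ρ)·(χ'(ρ)Φ_a'Φ_b')'·(χ'(ρ)Φ_c'Φ_d')'`. -/
noncomputable def Sterm (χ ρ Φa Φb Φc Φd : ℝ → ℝ) : ℝ → ℝ :=
  fun x => χ (ρ x) *
    deriv (fun y => deriv χ (ρ y) * deriv Φa y * deriv Φb y) x *
    deriv (fun y => deriv χ (ρ y) * deriv Φc y * deriv Φd y) x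

theorem aux_deriv_smooth {f : ℝ → ℝ} (hf : ContDiff ℝ (⊤ : ℕ∞) f) :
    ContDiff ℝ (⊤ : ℕ∞) (deriv f) := by
  have h : ContDiff ℝ ((⊤ : ℕ∞) + 1) f := by simpa using hf
  exact (contDiff_succ_iff_deriv.1 h).2.2

theorem aux_hasDeriv {f : ℝ → ℝ} (hf : ContDiff ℝ (⊤ : ℕ∞) f) (x : ℝ) :
    HasDerivAt f (deriv f x) x :=
  ((hf.differentiable (by simp)) x).hasDerivAt

theorem aux_comp {f ρ : ℝ → ℝ} (hf : ContDiff ℝ (⊤ : ℕ∞) f) (hρ : ContDiff ℝ (⊤ : ℕ∞) ρ)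
    (x : ℝ) : HasDerivAt (fun y => f (ρ y)) (deriv f (ρ x) * deriv ρ x) x :=
  (aux_hasDeriv hf (ρ x)).comp x (aux_hasDeriv hρ x)

theorem aux_Dchi {χ ρ Φ : ℝ → ℝ} (hχ : ContDiff ℝ (⊤ : ℕ∞) χ) (hρ : ContDiff ℝ (⊤ : ℕ∞) ρ)
    (hΦ : ContDiff ℝ (⊤ : ℕ∞) Φ) (x : ℝ) :
    Dchi χ ρ Φ x = deriv χ (ρ x) * deriv ρ x * deriv Φ x + χ (ρ x) * deriv (deriv Φ) x :=
  ((aux_comp hχ hρ x).mul (aux_hasDeriv (aux_deriv_smooth hΦ) x)).deriv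

theorem aux_M {χ ρ Φa Φb : ℝ → ℝ} (hχ : ContDiff ℝ (⊤ : ℕ∞) χ) (hρ : ContDiff ℝ (⊤ : ℕ∞) ρ)
    (ha : ContDiff ℝ (⊤ : ℕ∞) Φa) (hb : ContDiff ℝ (⊤ : ℕ∞) Φb) (x : ℝ) :
    deriv (fun y => deriv χ (ρ y) * deriv Φa y * deriv Φb y) x =
      (deriv (deriv χ) (ρ x) * deriv ρ x * deriv Φa x + deriv χ (ρ x) * deriv (deriv Φa) x)
        * deriv Φb x + deriv χ (ρ x) * deriv Φa x * deriv (deriv Φb) x :=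
  (((aux_comp (aux_deriv_smooth hχ) hρ x).mul (aux_hasDeriv (aux_deriv_smooth ha) x)).mul
    (aux_hasDeriv (aux_deriv_smooth hb) x)).deriv

theorem aux_Sterm {χ ρ Φa Φb Φc Φd : ℝ → ℝ} (hχ : ContDiff ℝ (⊤ : ℕ∞) χ)
    (hρ : ContDiff ℝ (⊤ : ℕ∞) ρ)
    (ha : ContDiff ℝ (⊤ : ℕ∞) Φa) (hb : ContDiff ℝ (⊤ : ℕ∞) Φb)
    (hc : ContDiff ℝ (⊤ : ℕ∞) Φc) (hd : ContDiff ℝ (⊤ : ℕ∞) Φd) (x : ℝ) :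
    Sterm χ ρ Φa Φb Φc Φd x = χ (ρ x) *
      ((deriv (deriv χ) (ρ x) * deriv ρ x * deriv Φa x + deriv χ (ρ x) * deriv (deriv Φa) x)
        * deriv Φb x + deriv χ (ρ x) * deriv Φa x * deriv (deriv Φb) x) *
      ((deriv (deriv χ) (ρ x) * deriv ρ x * deriv Φc x + deriv χ (ρ x) * deriv (deriv Φc) x)
        * deriv Φd x + deriv χ (ρ x) * deriv Φc x * deriv (deriv Φd) x) := by
  rw [Sterm, aux_M hχ hρ ha hb, aux_M hχ hρ hc hd]

theorem aux_Tterm {χ ρ Φa Φb Φc Φd : ℝ → ℝ} (hχ : ContDiff ℝ (⊤ : ℕ∞) χ)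
    (hρ : ContDiff ℝ (⊤ : ℕ∞) ρ)
    (ha : ContDiff ℝ (⊤ : ℕ∞) Φa) (hb : ContDiff ℝ (⊤ : ℕ∞) Φb)
    (hc : ContDiff ℝ (⊤ : ℕ∞) Φc) (x : ℝ) :
    Tterm χ ρ Φa Φb Φc Φd x = χ (ρ x) *
      ((deriv (deriv χ) (ρ x) * deriv ρ x *
        ((deriv (deriv χ) (ρ x) * deriv ρ x * deriv Φa x + deriv χ (ρ x) * deriv (deriv Φa) x)
          * deriv Φb x + deriv χ (ρ x) * deriv Φa x * deriv (deriv Φb) x)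
       + deriv χ (ρ x) *
        ((((deriv (deriv (deriv χ)) (ρ x) * deriv ρ x) * deriv ρ x
            + deriv (deriv χ) (ρ x) * deriv (deriv ρ) x) * deriv Φa x
          + deriv (deriv χ) (ρ x) * deriv ρ x * deriv (deriv Φa) x
          + (deriv (deriv χ) (ρ x) * deriv ρ x * deriv (deriv Φa) x
            + deriv χ (ρ x) * deriv (deriv (deriv Φa)) x)) * deriv Φb x
          + (deriv (deriv χ) (ρ x) * deriv ρ x * deriv Φa x
            + deriv χ (ρ x) * deriv (deriv Φa) x) * deriv (deriv Φb) x
          + ((deriv (deriv χ) (ρ x) * deriv ρ x * deriv Φa x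
            + deriv χ (ρ x) * deriv (deriv Φa) x) * deriv (deriv Φb) x
            + deriv χ (ρ x) * deriv Φa x * deriv (deriv (deriv Φb)) x))) * deriv Φc x
       + deriv χ (ρ x) *
        ((deriv (deriv χ) (ρ x) * deriv ρ x * deriv Φa x + deriv χ (ρ x) * deriv (deriv Φa) x)
          * deriv Φb x + deriv χ (ρ x) * deriv Φa x * deriv (deriv Φb) x) * deriv (deriv Φc) x)
      * deriv Φd x := by
  have hM := funext (aux_M hχ hρ ha hb)
  have hχ1 := aux_deriv_smooth hχ
  have hχ2 := aux_deriv_smooth hχ1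
  have ha1 := aux_deriv_smooth ha
  have hb1 := aux_deriv_smooth hb
  have dA := aux_comp hχ1 hρ x
  have dB := aux_comp hχ2 hρ x
  have dr := aux_hasDeriv (aux_deriv_smooth hρ) x
  have da := aux_hasDeriv ha1 x
  have da2 := aux_hasDeriv (aux_deriv_smooth ha1) x
  have db := aux_hasDeriv hb1 x
  have db2 := aux_hasDeriv (aux_deriv_smooth hb1) x
  have dc := aux_hasDeriv (aux_deriv_smooth hc) x
  have key := ((dA.mul (((((dB.mul dr).mul da).add (dA.mul da2)).mul db).add
    ((dA.mul da).mul db2))).mul dc).deriv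
  unfold Tterm
  simp only [aux_M hχ hρ ha hb]
  refine congrArg (fun t => χ (ρ x) * t * deriv Φd x) (key.trans ?_)
  simp only [Pi.mul_apply, Pi.add_apply]

/-- the one-dimensional Riemannian curvature identity. -/
theorem one_dim_riemannian_curvature (χ ρ Φ₁ Φ₂ Φ₃ Φ₄ : ℝ → ℝ)
    (hχ : ContDiff ℝ (⊤ : ℕ∞) χ) (hρ : ContDiff ℝ (⊤ : ℕ∞) ρ)
    (hΦ₁ : ContDiff ℝ (⊤ : ℕ∞) Φ₁) (hΦ₂ : ContDiff ℝ (⊤ : ℕ∞) Φ₂)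
    (hΦ₃ : ContDiff ℝ (⊤ : ℕ∞) Φ₃) (hΦ₄ : ContDiff ℝ (⊤ : ℕ∞) Φ₄)
    (hρper : Function.Periodic ρ 1)
    (hΦ₁per : Function.Periodic Φ₁ 1) (hΦ₂per : Function.Periodic Φ₂ 1)
    (hΦ₃per : Function.Periodic Φ₃ 1) (hΦ₄per : Function.Periodic Φ₄ 1) :
    (1/2 : ℝ) * (∫ x in (0:ℝ)..1, deriv (deriv χ) (ρ x) *
        (-(deriv Φ₂ x * deriv Φ₄ x * Dchi χ ρ Φ₁ x * Dchi χ ρ Φ₃ x)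
         - deriv Φ₁ x * deriv Φ₃ x * Dchi χ ρ Φ₂ x * Dchi χ ρ Φ₄ x
         + deriv Φ₂ x * deriv Φ₃ x * Dchi χ ρ Φ₁ x * Dchi χ ρ Φ₄ x
         + deriv Φ₁ x * deriv Φ₄ x * Dchi χ ρ Φ₂ x * Dchi χ ρ Φ₃ x))
    + (1/4 : ℝ) * (∫ x in (0:ℝ)..1,
        (-(Tterm χ ρ Φ₂ Φ₄ Φ₁ Φ₃ x) - Tterm χ ρ Φ₂ Φ₄ Φ₃ Φ₁ x
         - Tterm χ ρ Φ₁ Φ₃ Φ₂ Φ₄ x - Tterm χ ρ Φ₁ Φ₃ Φ₄ Φ₂ x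
         + Tterm χ ρ Φ₂ Φ₃ Φ₁ Φ₄ x + Tterm χ ρ Φ₂ Φ₃ Φ₄ Φ₁ x
         + Tterm χ ρ Φ₁ Φ₄ Φ₂ Φ₃ x + Tterm χ ρ Φ₁ Φ₄ Φ₃ Φ₂ x
         + Sterm χ ρ Φ₁ Φ₃ Φ₂ Φ₄ x - Sterm χ ρ Φ₂ Φ₃ Φ₁ Φ₄ x))
    + (1/4 : ℝ) * (∫ x in (0:ℝ)..1, χ (ρ x) * (deriv χ (ρ x))^2 *
        (Gc Φ₁ Φ₃ x * Gc Φ₂ Φ₄ x - Gc Φ₂ Φ₃ x * Gc Φ₁ Φ₄ x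
         + 2 * (Gc Φ₃ Φ₄ x * Gc Φ₁ Φ₂ x)))
    = (1/2 : ℝ) * (∫ x in (0:ℝ)..1, deriv (deriv χ) (ρ x) * (χ (ρ x))^2 *
        (-(deriv Φ₂ x * deriv Φ₄ x * deriv (deriv Φ₁) x * deriv (deriv Φ₃) x)
         - deriv Φ₁ x * deriv Φ₃ x * deriv (deriv Φ₂) x * deriv (deriv Φ₄) x
         + deriv Φ₂ x * deriv Φ₃ x * deriv (deriv Φ₁) x * deriv (deriv Φ₄) x
         + deriv Φ₁ x * deriv Φ₄ x * deriv (deriv Φ₂) x * deriv (deriv Φ₃) x)) := by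
  have c0 := hχ.continuous
  have hχ1 := aux_deriv_smooth hχ
  have c1 := hχ1.continuous
  have hχ2 := aux_deriv_smooth hχ1
  have c2 := hχ2.continuous
  have c3 := (aux_deriv_smooth hχ2).continuous
  have r0 := hρ.continuous
  have hρ1 := aux_deriv_smooth hρ
  have r1 := hρ1.continuous
  have r2 := (aux_deriv_smooth hρ1).continuous
  have hp1 := aux_deriv_smooth hΦ₁
  have p1 := hp1.continuous
  have hq1 := aux_deriv_smooth hp1
  have q1 := hq1.continuous
  have s1 := (aux_deriv_smooth hq1).continuous
  have hp2 := aux_deriv_smooth hΦ₂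
  have p2 := hp2.continuous
  have hq2 := aux_deriv_smooth hp2
  have q2 := hq2.continuous
  have s2 := (aux_deriv_smooth hq2).continuous
  have hp3 := aux_deriv_smooth hΦ₃
  have p3 := hp3.continuous
  have hq3 := aux_deriv_smooth hp3
  have q3 := hq3.continuous
  have s3 := (aux_deriv_smooth hq3).continuous
  have hp4 := aux_deriv_smooth hΦ₄
  have p4 := hp4.continuous
  have hq4 := aux_deriv_smooth hp4
  have q4 := hq4.continuous
  have s4 := (aux_deriv_smooth hq4).continuous
  simp only [aux_Dchi hχ hρ hΦ₁,
    aux_Dchi hχ hρ hΦ₂,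
    aux_Dchi hχ hρ hΦ₃,
    aux_Dchi hχ hρ hΦ₄,
    aux_Tterm hχ hρ hΦ₂ hΦ₄ hΦ₁ (Φd := Φ₃),
    aux_Tterm hχ hρ hΦ₂ hΦ₄ hΦ₃ (Φd := Φ₁),
    aux_Tterm hχ hρ hΦ₁ hΦ₃ hΦ₂ (Φd := Φ₄),
    aux_Tterm hχ hρ hΦ₁ hΦ₃ hΦ₄ (Φd := Φ₂),
    aux_Tterm hχ hρ hΦ₂ hΦ₃ hΦ₁ (Φd := Φ₄),
    aux_Tterm hχ hρ hΦ₂ hΦ₃ hΦ₄ (Φd := Φ₁),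
    aux_Tterm hχ hρ hΦ₁ hΦ₄ hΦ₂ (Φd := Φ₃),
    aux_Tterm hχ hρ hΦ₁ hΦ₄ hΦ₃ (Φd := Φ₂),
    aux_Sterm hχ hρ hΦ₁ hΦ₃ hΦ₂ hΦ₄,
    aux_Sterm hχ hρ hΦ₂ hΦ₃ hΦ₁ hΦ₄,
    Gc]
  simp only [← intervalIntegral.integral_const_mul]
  rw [← intervalIntegral.integral_add, ← intervalIntegral.integral_add]
  · refine intervalIntegral.integral_congr fun x _ => ?_
    ring
  all_goals
    apply Continuous.intervalIntegrable
    fun_prop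
end
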